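/- If (g_1, g_2) is a normal pair, then s(spair(g_1,g_2)) = max_{≤_sign}(s(u_1 g_1), s(u_2 g_2)); moreover, if s(u_1 g_1) >_sign s(u_2 g_2), then u_1 ≠ 1. -/

import Mathlib

open MvPolynomial

noncomputable section

namespace TropF5

/-- Variable index type: `none` is the homogenizing variable `h`,
`some (.inl i)` is `x i`, `some (.inr i)` is `∂ i` (resp. `ξ i`). -/
abbrev Vars (n : ℕ) := Option (Fin n ⊕ Fin n)

/-- The commutative polynomial ring `K[h, x, ξ]`. -/
abbrev Poly (n : ℕ) (K : Type*) [Field K] := MvPolynomial (Vars n) K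

/-- Monomials (exponent vectors) of `K[h,x,ξ]`. -/
abbrev Mon (n : ℕ) := Vars n →₀ ℕ

/-- Module monomials `h^γ x^α ξ^β e_i` of `K[h,x,ξ]^N`. -/
abbrev MMon (n N : ℕ) := Mon n × Fin N

/-- Total degree of a monomial. -/
def mdeg {n : ℕ} (d : Mon n) : ℕ := d.sum fun _ k => k

/-- The weight `w·(α,β)` of the `(x,ξ)`-part of a monomial. -/
def wdeg {n : ℕ} (w : Fin n ⊕ Fin n → ℝ) (d : Mon n) : ℝ :=
  ∑ j : Fin n ⊕ Fin n, w j * (d (some j) : ℝ)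

/-- The `(x,ξ)`-part `x^α ξ^β` of a monomial `h^γ x^α ξ^β`. -/
def xiPart {n : ℕ} (d : Mon n) : (Fin n ⊕ Fin n) →₀ ℕ :=
  Finsupp.equivFunOnFinite.symm fun j => d (some j)

/-- The data defining a tropical term order on `K[h,x,ξ]`: a valuation on `K`,
weight vectors `w, ω ∈ ℝ^{2n}`, and a monomial order `prec` used as tie-breaker. -/
structure OrdData (n : ℕ) (K : Type*) [Field K] where
  val : K → ℝ
  val_mul : ∀ a b : K, a ≠ 0 → b ≠ 0 → val (a * b) = val a + val b
  val_add : ∀ a b : K, a ≠ 0 → b ≠ 0 → a + b ≠ 0 → min (val a) (val b) ≤ val (a + b)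
  w : Fin n ⊕ Fin n → ℝ
  om : Fin n ⊕ Fin n → ℝ
  w_nonneg : ∀ i : Fin n, 0 ≤ w (Sum.inl i)
  w_big : ∀ i j : Fin n, w (Sum.inl j) < w (Sum.inr i)
  prec : LinearOrder ((Fin n ⊕ Fin n) →₀ ℕ)
  prec_add : ∀ u v t : (Fin n ⊕ Fin n) →₀ ℕ, prec.lt u v → prec.lt (u + t) (v + t)
  prec_zero_le : ∀ u, prec.le 0 u

variable {n N : ℕ} {K : Type*} [Field K]

/-- The strict tropical term order `<_h` on terms `a·d`, `b·e` of `K[h,x,ξ]`: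
first by total degree, then by `w`-weight, then by valuation-adjusted `ω`-weight,
and finally by the tie-breaking monomial order on the `(x,ξ)`-parts. -/
def ltTerm (D : OrdData n K) (a : K) (d : Mon n) (b : K) (e : Mon n) : Prop :=
  mdeg d < mdeg e ∨ (mdeg d = mdeg e ∧
    (wdeg D.w d < wdeg D.w e ∨ (wdeg D.w d = wdeg D.w e ∧
      (-D.val a + wdeg D.om d < -D.val b + wdeg D.om e ∨
        (-D.val a + wdeg D.om d = -D.val b + wdeg D.om e ∧
          D.prec.lt (xiPart d) (xiPart e))))))

/-- `d` is the `≤_h`-leading monomial of the polynomial `p`. -/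
def IsLM (D : OrdData n K) (p : Poly n K) (d : Mon n) : Prop :=
  d ∈ p.support ∧ ∀ e ∈ p.support, e ≠ d → ltTerm D (p.coeff e) e (p.coeff d) d

open Classical in
/-- The `≤_h`-leading monomial of a polynomial (junk value `0` if there is none). -/
def LM (D : OrdData n K) (p : Poly n K) : Mon n :=
  if h : ∃ d, IsLM D p d then h.choose else 0

/-- The module element `σ e_i` of `K[h,x,ξ]^N` corresponding to a module monomial. -/
def msingle {N : ℕ} (m : MMon n N) : Fin N → Poly n K := Pi.single m.2 (monomial m.1 1)

/-- Product of a monomial with a module monomial. -/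
def mulM {N : ℕ} (d : Mon n) (m : MMon n N) : MMon n N := (d + m.1, m.2)

/-- An abstract setting for the homogenized Weyl algebra `R = D_n^{(h)}(K)`:
a `K`-algebra `R` with generators `h, x_i, ∂_i` satisfying the Weyl relations,
the total-symbol `K`-linear isomorphism `Ψ_h : R ≃ K[h,x,ξ]` sending normally
ordered monomials to monomials, a tropical order datum, and a generating family
`F` of homogeneous elements. -/
structure Setting (n N : ℕ) (K : Type*) [Field K] (R : Type*) [Ring R] [Algebra K R] where
  D : OrdData n K
  /-- the generators: `Xg none = h`, `Xg (some (.inl i)) = x i`, `Xg (some (.inr i)) = ∂ i` -/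
  Xg : Vars n → R
  h_comm : ∀ v, Xg none * Xg v = Xg v * Xg none
  x_comm : ∀ i j : Fin n,
    Xg (some (Sum.inl i)) * Xg (some (Sum.inl j)) = Xg (some (Sum.inl j)) * Xg (some (Sum.inl i))
  d_comm : ∀ i j : Fin n,
    Xg (some (Sum.inr i)) * Xg (some (Sum.inr j)) = Xg (some (Sum.inr j)) * Xg (some (Sum.inr i))
  dx_comm : ∀ i j : Fin n, i ≠ j →
    Xg (some (Sum.inr i)) * Xg (some (Sum.inl j)) = Xg (some (Sum.inl j)) * Xg (some (Sum.inr i))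
  dx_h : ∀ i : Fin n,
    Xg (some (Sum.inr i)) * Xg (some (Sum.inl i))
      = Xg (some (Sum.inl i)) * Xg (some (Sum.inr i)) + Xg none ^ 2
  /-- the total symbol map `Ψ_h` -/
  Psi : R ≃ₗ[K] Poly n K
  Psi_monomial : ∀ d : Mon n,
    Psi (Xg none ^ d none *
      ((List.ofFn fun i : Fin n => Xg (some (Sum.inl i)) ^ d (some (Sum.inl i))).prod *
       (List.ofFn fun i : Fin n => Xg (some (Sum.inr i)) ^ d (some (Sum.inr i))).prod)) =
    monomial d 1
  /-- the generating set `F = {f_1, …, f_N}` -/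
  F : Fin N → R
  F_hom : ∀ i, ∃ dF : ℕ, (Psi (F i)).IsHomogeneous dF

namespace Setting

variable {R : Type*} [Ring R] [Algebra K R] [NeZero N] (S : Setting n N K R)

/-- `ν : R^N → I`, `ν(a) = Σ a_i f_i`. -/
def nu (g : Fin N → R) : R := ∑ i, g i * S.F i

/-- The left ideal `I` generated by `F`. -/
def idl : Submodule R R := Submodule.span R (Set.range S.F)

/-- The componentwise total symbol map `Φ : R^N → K[h,x,ξ]^N`. -/
def Phi (g : Fin N → R) : Fin N → Poly n K := fun i => S.Psi (g i)

/-- The inverse total symbol of a monomial: the monomial `h^γ x^α ∂^β` of `R`. -/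
def monR (d : Mon n) : R := S.Psi.symm (monomial d 1)

/-- `t` is a term (nonzero coefficient times a monomial) of `R`. -/
def IsTermR (t : R) : Prop := ∃ (d : Mon n) (c : K), c ≠ 0 ∧ S.Psi t = monomial d c

/-- `≤_h`-leading monomial of an element of `R` (via its total symbol). -/
def LMr (f : R) : Mon n := LM S.D (S.Psi f)

/-- `≤_h`-leading coefficient of an element of `R`. -/
def LCr (f : R) : K := (S.Psi f).coeff (S.LMr f)

/-- `LT_h f ≤_h LT_h g` (strictly smaller, or equal monomials and equal valuations). -/
def leLT (f g : R) : Prop :=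
  ltTerm S.D (S.LCr f) (S.LMr f) (S.LCr g) (S.LMr g) ∨
    (S.D.val (S.LCr f) = S.D.val (S.LCr g) ∧ S.LMr f = S.LMr g)


/-- `m` is the leading monomial of the syzygy `a`: writing `m = (d, i)`,
`i` is the largest index with `a i ≠ 0` and `d = LM_h (a i)`. -/
def IsSyzLM (m : MMon n N) : Prop :=
  ∃ a : Fin N → R, S.nu a = 0 ∧ a m.2 ≠ 0 ∧ (∀ j, m.2 < j → a j = 0) ∧
    IsLM S.D (S.Psi (a m.2)) m.1

/-- `LSyz(F)`: the `K[h,x,ξ]`-submodule generated by leading monomials of syzygies. -/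
def LSyz : Submodule (Poly n K) (Fin N → Poly n K) :=
  Submodule.span _ { v | ∃ m : MMon n N, S.IsSyzLM m ∧ v = msingle m }

/-- Membership of a module monomial in `LSyz(F)`. -/
def inLSyz (m : MMon n N) : Prop := msingle m ∈ S.LSyz

/-- The strict total order `<_sign` on module monomials. -/
def ltSign (m m' : MMon n N) : Prop :=
  m.2 < m'.2 ∨ (m.2 = m'.2 ∧ (mdeg m.1 < mdeg m'.1 ∨ (mdeg m.1 = mdeg m'.1 ∧
    (wdeg S.D.w m.1 < wdeg S.D.w m'.1 ∨ (wdeg S.D.w m.1 = wdeg S.D.w m'.1 ∧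
      ((¬ S.inLSyz m ∧ S.inLSyz m') ∨
        ((S.inLSyz m ↔ S.inLSyz m') ∧ S.D.prec.lt (xiPart m.1) (xiPart m'.1))))))))

/-- `m` is the `≤_sign`-largest module monomial of `Φ(g)`. -/
def IsLMsign (g : Fin N → R) (m : MMon n N) : Prop :=
  m.1 ∈ (S.Psi (g m.2)).support ∧
    ∀ m' : MMon n N, m'.1 ∈ (S.Psi (g m'.2)).support → m' ≠ m → S.ltSign m' m

open Classical in
/-- `LM_sign(g)` (junk value if there is none). -/
def LMsign (g : Fin N → R) : MMon n N :=
  if h : ∃ m, S.IsLMsign g m then h.choose else ((0 : Mon n), (0 : Fin N))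

/-- `m` is the signature of `f`: the `≤_sign`-minimum of
`{LM_sign(g) : ν(g) = f}`. -/
def IsSig (f : R) (m : MMon n N) : Prop :=
  (∃ g : Fin N → R, S.nu g = f ∧ S.IsLMsign g m) ∧
    ∀ (g : Fin N → R) (m' : MMon n N), S.nu g = f → S.IsLMsign g m' → ¬ S.ltSign m' m

open Classical in
/-- The signature `s(f)` of `f ∈ I \ {0}` (junk value if there is none). -/
def sig (f : R) : MMon n N :=
  if h : ∃ m, S.IsSig f m then h.choose else ((0 : Mon n), (0 : Fin N))


/-- A module element is clean if `ν(g) ≠ 0` and no module monomial of `Φ(g)`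
belongs to `LSyz(F)`. -/
def Clean (g : Fin N → R) : Prop :=
  S.nu g ≠ 0 ∧ ∀ m : MMon n N, m.1 ∈ (S.Psi (g m.2)).support → ¬ S.inLSyz m

/-- `f` is `s`-top-reducible with respect to the module monomial `m`:
some `g ∈ I \ {0}` and term `t` satisfy `LM_h(t g) = LM_h(f)` and `s(t g) <_sign m`. -/
def sTopRed (f : R) (m : MMon n N) : Prop :=
  ∃ g ∈ S.idl, g ≠ 0 ∧ ∃ t : R, S.IsTermR t ∧
    S.LMr (t * g) = S.LMr f ∧ S.ltSign (S.sig (t * g)) m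

/-- `f` is `s`-top-irreducible with respect to `m`. -/
def sTopIrr (f : R) (m : MMon n N) : Prop := f = 0 ∨ ¬ S.sTopRed f m

/-- `σ` is the value `Ω(m)`: the `≤_sign`-minimum of
`{s(f) : f ∈ I \ {0}, LM_h(f) = m}`. -/
def IsOmega (m : Mon n) (σ : MMon n N) : Prop :=
  (∃ f, f ∈ S.idl ∧ f ≠ 0 ∧ S.LMr f = m ∧ S.sig f = σ) ∧
    ∀ f, f ∈ S.idl → f ≠ 0 → S.LMr f = m → ¬ S.ltSign (S.sig f) σ

open Classical in
/-- The map `Ω` (junk value if the minimum does not exist). -/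
def Omega (m : Mon n) : MMon n N :=
  if h : ∃ σ, S.IsOmega m σ then h.choose else ((0 : Mon n), (0 : Fin N))

/-- `G` is an `s`-Gröbner basis of `I`. -/
def IsSGB (G : Set R) : Prop :=
  G.Nonempty ∧ Submodule.span R G = S.idl ∧
    ∀ f ∈ S.idl, f ≠ 0 → S.sTopIrr f (S.sig f) →
      ∃ g ∈ G, ∃ d : Mon n,
        S.LMr (S.monR d * g) = S.LMr f ∧ mulM d (S.sig g) = S.sig f

/-- `G` is a (tropical) Gröbner basis of `I`:
`RG = I` and `⟨LM_h(G)⟩ = ⟨LM_h(I)⟩`. -/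
def IsGB (G : Set R) : Prop :=
  G.Nonempty ∧ Submodule.span R G = S.idl ∧
    Ideal.span ((fun g => (monomial (S.LMr g) 1 : Poly n K)) '' {g | g ∈ G ∧ g ≠ 0}) =
      Ideal.span ((fun g => (monomial (S.LMr g) 1 : Poly n K)) '' {f | f ∈ S.idl ∧ f ≠ 0})

/-- `g` is primitive `s`-top-irreducible. -/
def Primitive (g : R) : Prop :=
  g ∈ S.idl ∧ g ≠ 0 ∧ S.sTopIrr g (S.sig g) ∧
    ¬ ∃ g', g' ∈ S.idl ∧ g' ≠ 0 ∧ S.sTopIrr g' (S.sig g') ∧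
      ∃ d : Mon n, d ≠ 0 ∧ S.LMr (S.monR d * g') = S.LMr g ∧
        S.sig (S.monR d * g') = S.sig g

/-- `f` is redundant to `G`. -/
def Redundant (f : R) (G : Set R) : Prop :=
  f ≠ 0 ∧ ∃ g ∈ G, ∃ (d : Mon n) (c : K), c ≠ 0 ∧
    f = S.Psi.symm (monomial d c) * g ∧ S.ltSign (S.sig f) (mulM d (S.sig g))

/-- The cofactor `u_1` of the S-pair of `(g_1, g_2)`. -/
def u1 (g1 g2 : R) : R :=
  S.Psi.symm (monomial ((S.LMr g1 ⊔ S.LMr g2) - S.LMr g1) (S.LCr g2))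

/-- The cofactor `u_2` of the S-pair of `(g_1, g_2)`. -/
def u2 (g1 g2 : R) : R :=
  S.Psi.symm (monomial ((S.LMr g1 ⊔ S.LMr g2) - S.LMr g2) (S.LCr g1))

/-- The S-pair `spair(g_1, g_2) = u_1 g_1 - u_2 g_2`. -/
def spair (g1 g2 : R) : R := S.u1 g1 g2 * g1 - S.u2 g1 g2 * g2

/-- `(g_1, g_2)` is a normal pair relative to `G`. -/
def NormalPair (G : Set R) (g1 g2 : R) : Prop :=
  S.Primitive g1 ∧ S.Primitive g2 ∧
    S.sig (S.u1 g1 g2 * g1) = mulM ((S.LMr g1 ⊔ S.LMr g2) - S.LMr g1) (S.sig g1) ∧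
    S.sig (S.u2 g1 g2 * g2) = mulM ((S.LMr g1 ⊔ S.LMr g2) - S.LMr g2) (S.sig g2) ∧
    S.sig (S.u1 g1 g2 * g1) ≠ S.sig (S.u2 g1 g2 * g2) ∧
    ¬ S.Redundant (S.spair g1 g2) G

end Setting

end TropF5

namespace TropF5

variable {n N : ℕ} {K R : Type*} [Field K] [Ring R] [Algebra K R]

/-- Exponent vectors of the `(x,ξ)`-part, ordered by the tie-breaking monomial order. -/
def PrecMon {n : ℕ} {K : Type*} [Field K] (_ : OrdData n K) : Type := (Fin n ⊕ Fin n) →₀ ℕ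

instance (D : OrdData n K) : LinearOrder (PrecMon D) := D.prec

theorem mdeg_eq_degree (d : Mon n) : mdeg d = d.degree := rfl

theorem mdeg_add (d e : Mon n) : mdeg (d + e) = mdeg d + mdeg e := by
  simp [mdeg_eq_degree]

theorem wdeg_add (w : Fin n ⊕ Fin n → ℝ) (d e : Mon n) :
    wdeg w (d + e) = wdeg w d + wdeg w e := by
  simp [wdeg, mul_add, Finset.sum_add_distrib]

theorem wdeg_single_none (w : Fin n ⊕ Fin n → ℝ) (k : ℕ) :
    wdeg w (Finsupp.single none k) = 0 := by
  simp [wdeg]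

theorem wdeg_single_some (w : Fin n ⊕ Fin n → ℝ) (j : Fin n ⊕ Fin n) :
    wdeg w (Finsupp.single (some j) 1) = w j := by
  classical
  simp [wdeg, Finsupp.single_apply]

theorem xiPart_add (d e : Mon n) : xiPart (d + e) = xiPart d + xiPart e := by
  ext j
  simp [xiPart]

theorem mon_eq_of_mdeg_of_xiPart {d e : Mon n} (h : mdeg d = mdeg e)
    (hx : xiPart d = xiPart e) : d = e := by
  have hs : ∀ j, d (some j) = e (some j) := fun j => DFunLike.congr_fun hx j
  have h' : d none = e none := by
    rw [mdeg_eq_degree, mdeg_eq_degree, Finsupp.degree_eq_sum, Finsupp.degree_eq_sum,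
      Fintype.sum_option, Fintype.sum_option] at h
    simp only [hs] at h
    omega
  ext v
  rcases v with _ | j
  · exact h'
  · exact hs j

/-- The lexicographic key by which the tropical term order compares terms. -/
def termKey (D : OrdData n K) (a : K) (d : Mon n) : ℕ ×ₗ ℝ ×ₗ ℝ ×ₗ PrecMon D :=
  toLex (mdeg d, toLex (wdeg D.w d, toLex (-D.val a + wdeg D.om d, xiPart d)))

theorem ltTerm_iff (D : OrdData n K) (a b : K) (d e : Mon n) :
    ltTerm D a d b e ↔ termKey D a d < termKey D b e := by
  simp only [ltTerm, termKey, Prod.Lex.toLex_lt_toLex]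
  rfl

theorem eq_of_termKey_eq {D : OrdData n K} {a b : K} {d e : Mon n}
    (h : termKey D a d = termKey D b e) : d = e := by
  obtain ⟨h1, h⟩ := Prod.ext_iff.mp h
  obtain ⟨_, h⟩ := Prod.ext_iff.mp h
  exact mon_eq_of_mdeg_of_xiPart h1 (Prod.ext_iff.mp h).2

theorem exists_isLM (D : OrdData n K) {p : Poly n K} (hp : p ≠ 0) : ∃ d, IsLM D p d := by
  obtain ⟨d, hd, hmax⟩ := p.support.exists_max_image (fun e => termKey D (p.coeff e) e)
    (support_nonempty.mpr hp)
  refine ⟨d, hd, fun e he hne => (ltTerm_iff ..).mpr ?_⟩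
  exact lt_of_le_of_ne (hmax e he) fun h => hne (eq_of_termKey_eq h)

theorem IsLM.unique {D : OrdData n K} {p : Poly n K} {d e : Mon n}
    (hd : IsLM D p d) (he : IsLM D p e) : d = e := by
  by_contra hne
  have h1 := hd.2 e he.1 (Ne.symm hne)
  have h2 := he.2 d hd.1 hne
  rw [ltTerm_iff] at h1 h2
  exact lt_asymm h1 h2

theorem IsLM.LM_eq {D : OrdData n K} {p : Poly n K} {d : Mon n} (hd : IsLM D p d) :
    LM D p = d := by
  have h : ∃ d, IsLM D p d := ⟨d, hd⟩
  rw [LM, dif_pos h]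
  exact h.choose_spec.unique hd

theorem isLM_LM (D : OrdData n K) {p : Poly n K} (hp : p ≠ 0) : IsLM D p (LM D p) := by
  obtain ⟨d, hd⟩ := exists_isLM D hp
  rwa [hd.LM_eq]

theorem ltTerm_mul_left {D : OrdData n K} {a b c : K} {d e t : Mon n} (ha : a ≠ 0) (hb : b ≠ 0)
    (hc : c ≠ 0) (h : ltTerm D a d b e) : ltTerm D (c * a) (t + d) (c * b) (t + e) := by
  simp only [ltTerm, mdeg_add, wdeg_add, xiPart_add, D.val_mul c a hc ha,
    D.val_mul c b hc hb] at h ⊢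
  have hp : D.prec.lt (xiPart d) (xiPart e) →
      D.prec.lt (xiPart t + xiPart d) (xiPart t + xiPart e) := fun h => by
    rw [add_comm (xiPart t), add_comm (xiPart t)]
    exact D.prec_add _ _ _ h
  rcases h with h | ⟨h, h1 | ⟨h1, h2 | ⟨h2, h3⟩⟩⟩
  · exact Or.inl (by omega)
  · exact Or.inr ⟨by omega, Or.inl (by linarith)⟩
  · exact Or.inr ⟨by omega, Or.inr ⟨by linarith, Or.inl (by linarith)⟩⟩
  · exact Or.inr ⟨by omega, Or.inr ⟨by linarith, Or.inr ⟨by linarith, hp h3⟩⟩⟩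

/-- Strict comparison of monomials by total degree, then by `w`-weight. -/
def DegLT (w : Fin n ⊕ Fin n → ℝ) (d e : Mon n) : Prop :=
  mdeg d < mdeg e ∨ (mdeg d = mdeg e ∧ wdeg w d < wdeg w e)

/-- A perturbation by terms of smaller degree or weight keeps the leading monomial of a product
with a monomial. -/
theorem IsLM.monomial_mul_add {D : OrdData n K} {p q : Poly n K} {d t : Mon n} {c : K}
    (hc : c ≠ 0) (hp : IsLM D p d) (hq : ∀ m ∈ q.support, DegLT D.w m (t + d)) :
    IsLM D (monomial t c * p + q) (t + d) := by
  have hq0 : q.coeff (t + d) = 0 := by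
    by_contra h
    rcases hq _ (mem_support_iff.mpr h) with h | ⟨_, h⟩ <;> exact lt_irrefl _ h
  have hcoeff : (monomial t c * p + q).coeff (t + d) = c * p.coeff d := by
    rw [coeff_add, hq0, coeff_monomial_mul, add_zero]
  refine ⟨?_, fun m hm hne => ?_⟩
  · rw [mem_support_iff, hcoeff]
    exact mul_ne_zero hc (mem_support_iff.mp hp.1)
  · by_cases hmq : m ∈ q.support
    · rcases hq m hmq with h | ⟨h, h'⟩
      · exact Or.inl h
      · exact Or.inr ⟨h, Or.inl h'⟩
    · have hqm : q.coeff m = 0 := notMem_support_iff.mp hmq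
      rw [mem_support_iff, coeff_add, hqm, add_zero] at hm
      have htm : t ≤ m := by
        by_contra h
        exact hm (by rw [coeff_monomial_mul', if_neg h])
      obtain ⟨e, rfl⟩ := exists_add_of_le htm
      rw [coeff_monomial_mul] at hm
      rw [hcoeff, coeff_add, hqm, add_zero, coeff_monomial_mul]
      have he := right_ne_zero_of_mul hm
      exact ltTerm_mul_left he (mem_support_iff.mp hp.1) hc
        (hp.2 e (mem_support_iff.mpr he) fun h => hne (by rw [h]))

theorem mul_prod_ofFn_pow {R : Type*} [Ring R] : ∀ {n : ℕ} (a : Fin n → R),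
    (∀ i j, a i * a j = a j * a i) → ∀ (i : Fin n) (k k' : Fin n → ℕ),
      (∀ j, k' j = k j + if j = i then 1 else 0) →
        a i * (List.ofFn fun j => a j ^ k j).prod = (List.ofFn fun j => a j ^ k' j).prod
  | 0, _, _, i, _, _, _ => i.elim0
  | n + 1, a, ha, i, k, k', hk => by
    rw [List.ofFn_succ, List.ofFn_succ, List.prod_cons, List.prod_cons]
    induction i using Fin.cases with
    | zero =>
      have h1 : ∀ j : Fin n, k' j.succ = k j.succ := fun j => by
        simpa [Fin.succ_ne_zero] using hk j.succ
      rw [← mul_assoc, ← pow_succ', hk 0, if_pos rfl]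
      simp only [h1]
    | succ i =>
      have h0 : k' 0 = k 0 := by simpa [(Fin.succ_ne_zero i).symm] using hk 0
      rw [h0, ← mul_assoc, (Commute.pow_right (show Commute (a i.succ) (a 0) from ha _ _) _).eq,
        mul_assoc, mul_prod_ofFn_pow (fun j => a j.succ) (fun _ _ => ha _ _) i
          (fun j => k j.succ) (fun j => k' j.succ) fun j => by
            simpa [Fin.succ_inj] using hk j.succ]

namespace Setting

variable (S : Setting n N K R)

theorem monR_eq (d : Mon n) : S.monR d = S.Xg none ^ d none *
    ((List.ofFn fun i : Fin n => S.Xg (some (Sum.inl i)) ^ d (some (Sum.inl i))).prod *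
      (List.ofFn fun i : Fin n => S.Xg (some (Sum.inr i)) ^ d (some (Sum.inr i))).prod) := by
  rw [monR, LinearEquiv.symm_apply_eq, S.Psi_monomial]

theorem monR_zero : S.monR 0 = 1 := by
  simp [monR_eq]

theorem h_mul_monR (e : Mon n) : S.Xg none * S.monR e = S.monR (Finsupp.single none 1 + e) := by
  rw [monR_eq, monR_eq, ← mul_assoc, ← pow_succ']
  simp [add_comm]

theorem x_mul_monR (i : Fin n) (e : Mon n) : S.Xg (some (Sum.inl i)) * S.monR e =
    S.monR (Finsupp.single (some (Sum.inl i)) 1 + e) := by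
  have hc : Commute (S.Xg (some (Sum.inl i))) (S.Xg none ^ e none) :=
    Commute.pow_right (S.h_comm _).symm _
  rw [monR_eq, monR_eq, ← mul_assoc, hc.eq, mul_assoc, ← mul_assoc (S.Xg (some (Sum.inl i))),
    mul_prod_ofFn_pow (fun j => S.Xg (some (Sum.inl j))) S.x_comm i _
      (fun j => (Finsupp.single (some (Sum.inl i)) 1 + e : Mon n) (some (Sum.inl j)))]
  · simp
  · intro j
    simp [Finsupp.single_apply, add_comm, eq_comm]

theorem d_mul_monR_of_eq_zero (i : Fin n) {e : Mon n} (h0 : e none = 0)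
    (hx : ∀ j, e (some (Sum.inl j)) = 0) : S.Xg (some (Sum.inr i)) * S.monR e =
      S.monR (Finsupp.single (some (Sum.inr i)) 1 + e) := by
  have hl : List.ofFn (fun _ : Fin n => (1 : R)) = List.replicate n 1 := List.ofFn_const ..
  rw [monR_eq, monR_eq]
  simp only [h0, hx, Finsupp.add_apply, pow_zero, one_mul, hl, List.prod_replicate, one_pow,
    Finsupp.single_apply, reduceCtorEq, if_false, add_zero, Option.some.injEq]
  refine mul_prod_ofFn_pow (fun j => S.Xg (some (Sum.inr j))) S.d_comm i _ _ fun j => ?_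
  simp [add_comm, eq_comm]

/-- The span of the monomials of `R` with the same total degree as `d` and smaller `w`-weight. -/
def lower (d : Mon n) : Submodule K R :=
  Submodule.span K (S.monR '' {m | mdeg m = mdeg d ∧ wdeg S.D.w m < wdeg S.D.w d})

theorem support_of_mem_lower {d : Mon n} {r : R} (hr : r ∈ S.lower d) :
    ∀ m ∈ (S.Psi r).support, mdeg m = mdeg d ∧ wdeg S.D.w m < wdeg S.D.w d := by
  classical
  induction hr using Submodule.span_induction with
  | mem r hr =>
    obtain ⟨e, he, rfl⟩ := hr
    intro m hm
    rw [monR, LinearEquiv.apply_symm_apply] at hm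
    rwa [Finset.mem_singleton.mp (support_monomial_subset hm)]
  | zero => simp
  | add a b _ _ ha hb =>
    intro m hm
    rw [map_add] at hm
    rcases Finset.mem_union.mp (support_add hm) with h | h
    exacts [ha m h, hb m h]
  | smul c a _ ha =>
    intro m hm
    rw [map_smul] at hm
    exact ha m (support_smul hm)

/-- `r` acts on monomials from the left like the monomial with exponent `d`, up to terms of the
same degree and smaller `w`-weight. -/
def ActsLike (r : R) (d : Mon n) : Prop :=
  ∀ e, r * S.monR e - S.monR (d + e) ∈ S.lower (d + e)

variable {S}

theorem mem_lower_of_le {d e : Mon n} (hd : mdeg d = mdeg e)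
    (hw : wdeg S.D.w d ≤ wdeg S.D.w e) : S.lower d ≤ S.lower e :=
  Submodule.span_mono <| Set.image_mono fun _ hm =>
    ⟨hm.1.trans hd, hm.2.trans_le hw⟩

theorem monR_mem_lower {d e : Mon n} (hd : mdeg d = mdeg e)
    (hw : wdeg S.D.w d < wdeg S.D.w e) : S.monR d ∈ S.lower e :=
  Submodule.subset_span ⟨d, ⟨hd, hw⟩, rfl⟩

theorem ActsLike.mul_mem_lower {r s : R} {d e : Mon n} (hr : S.ActsLike r d)
    (hs : s ∈ S.lower e) : r * s ∈ S.lower (d + e) := by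
  induction hs using Submodule.span_induction with
  | mem s hs =>
    obtain ⟨m, ⟨hm, hw⟩, rfl⟩ := hs
    have h1 : mdeg (d + m) = mdeg (d + e) := by rw [mdeg_add, mdeg_add, hm]
    have h2 : wdeg S.D.w (d + m) < wdeg S.D.w (d + e) := by
      rw [wdeg_add, wdeg_add]; linarith
    rw [← sub_add_cancel (r * S.monR m) (S.monR (d + m))]
    exact add_mem (mem_lower_of_le h1 h2.le (hr m)) (monR_mem_lower h1 h2)
  | zero => simp
  | add a b _ _ ha hb => rw [mul_add]; exact add_mem ha hb
  | smul c a _ ha => rw [mul_smul_comm]; exact Submodule.smul_mem _ _ ha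

theorem actsLike_of_eq {r : R} {d : Mon n} (h : ∀ e, r * S.monR e = S.monR (d + e)) :
    S.ActsLike r d := fun e => by
  rw [h, sub_self]
  exact zero_mem _

theorem ActsLike.mul {r s : R} {d e : Mon n} (hr : S.ActsLike r d) (hs : S.ActsLike s e) :
    S.ActsLike (r * s) (d + e) := fun m => by
  have h1 := hr.mul_mem_lower (hs m)
  have h2 := hr (e + m)
  rw [add_assoc]
  convert add_mem h1 h2 using 1
  rw [mul_sub, mul_assoc]
  abel

theorem actsLike_one : S.ActsLike 1 0 := actsLike_of_eq fun e => by simp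

theorem ActsLike.pow {r : R} {d : Mon n} (hr : S.ActsLike r d) :
    ∀ k : ℕ, S.ActsLike (r ^ k) (k • d)
  | 0 => by simpa using actsLike_one
  | k + 1 => by
    rw [pow_succ', add_smul, one_smul, add_comm]
    exact hr.mul (hr.pow k)

theorem actsLike_prod_ofFn : ∀ {k : ℕ} (r : Fin k → R) (d : Fin k → Mon n),
    (∀ i, S.ActsLike (r i) (d i)) → S.ActsLike (List.ofFn r).prod (∑ i, d i)
  | 0, _, _, _ => by simpa using actsLike_one
  | k + 1, r, d, h => by
    rw [List.ofFn_succ, List.prod_cons, Fin.sum_univ_succ]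
    exact (h 0).mul (actsLike_prod_ofFn _ _ fun i => h i.succ)

theorem actsLike_h : S.ActsLike (S.Xg none) (Finsupp.single none 1) :=
  actsLike_of_eq S.h_mul_monR

theorem actsLike_x (i : Fin n) :
    S.ActsLike (S.Xg (some (Sum.inl i))) (Finsupp.single (some (Sum.inl i)) 1) :=
  actsLike_of_eq (S.x_mul_monR i)

theorem d_mul_monR_add_sub_mem {i : Fin n} {e δ : Mon n} {r : R} (hr : S.ActsLike r δ)
    (hmon : ∀ m, r * S.monR m = S.monR (δ + m))
    (hcomm : S.Xg (some (Sum.inr i)) * r - r * S.Xg (some (Sum.inr i)) = 0 ∨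
      (S.Xg (some (Sum.inr i)) * r - r * S.Xg (some (Sum.inr i)) = S.Xg none ^ 2 ∧
        δ = Finsupp.single (some (Sum.inl i)) 1))
    (he : S.Xg (some (Sum.inr i)) * S.monR e - S.monR (Finsupp.single (some (Sum.inr i)) 1 + e) ∈
      S.lower (Finsupp.single (some (Sum.inr i)) 1 + e)) :
    S.Xg (some (Sum.inr i)) * S.monR (δ + e) -
        S.monR (Finsupp.single (some (Sum.inr i)) 1 + (δ + e)) ∈
      S.lower (Finsupp.single (some (Sum.inr i)) 1 + (δ + e)) := by
  set D := S.Xg (some (Sum.inr i))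
  have h1 := hr.mul_mem_lower he
  rw [mul_sub, hmon, add_left_comm] at h1
  have h2 : (D * r - r * D) * S.monR e ∈
      S.lower (Finsupp.single (some (Sum.inr i)) 1 + (δ + e)) := by
    rcases hcomm with h | ⟨h, rfl⟩
    · rw [h, zero_mul]
      exact zero_mem _
    · rw [h, pow_two, mul_assoc, h_mul_monR, h_mul_monR]
      have hw := S.D.w_nonneg i
      have hw' := S.D.w_big i i
      refine monR_mem_lower ?_ ?_
      · simp [mdeg_eq_degree]
      · simp only [wdeg_add, wdeg_single_none, wdeg_single_some]
        linarith
  convert add_mem h1 h2 using 1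
  rw [← hmon, sub_mul]
  simp only [mul_assoc]
  abel

theorem actsLike_d (i : Fin n) :
    S.ActsLike (S.Xg (some (Sum.inr i))) (Finsupp.single (some (Sum.inr i)) 1) := by
  intro e
  induction hk : mdeg e using Nat.strong_induction_on generalizing e with
  | _ k ih =>
  subst hk
  have hsub : ∀ v, e v ≠ 0 → Finsupp.single v 1 + (e - Finsupp.single v 1) = e := fun v hv =>
    add_tsub_cancel_of_le (Finsupp.single_le_iff.mpr (Nat.one_le_iff_ne_zero.mpr hv))
  have hlt : ∀ v, e v ≠ 0 → mdeg (e - Finsupp.single v 1) < mdeg e := fun v hv => by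
    conv_rhs => rw [← hsub v hv, mdeg_add]
    simp [mdeg_eq_degree]
  by_cases h0 : e none = 0
  · by_cases hx : ∀ j, e (some (Sum.inl j)) = 0
    · rw [d_mul_monR_of_eq_zero S i h0 hx, sub_self]
      exact zero_mem _
    · push Not at hx
      obtain ⟨j, hj⟩ := hx
      rw [← hsub _ hj]
      refine d_mul_monR_add_sub_mem (actsLike_x j) (S.x_mul_monR j) ?_ (ih _ (hlt _ hj) _ rfl)
      by_cases hij : i = j
      · subst hij
        refine Or.inr ⟨?_, rfl⟩
        rw [S.dx_h]
        abel
      · exact Or.inl (by rw [S.dx_comm i j hij, sub_self])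
  · rw [← hsub _ h0]
    exact d_mul_monR_add_sub_mem actsLike_h S.h_mul_monR (Or.inl (by rw [S.h_comm, sub_self]))
      (ih _ (hlt _ h0) _ rfl)

theorem actsLike_monR (d : Mon n) : S.ActsLike (S.monR d) d := by
  have h := (actsLike_h (S := S)).pow (d none) |>.mul <|
    (actsLike_prod_ofFn _ _ fun i => (actsLike_x (S := S) i).pow (d (some (Sum.inl i)))).mul
      (actsLike_prod_ofFn _ _ fun i => (actsLike_d (S := S) i).pow (d (some (Sum.inr i))))
  rw [← monR_eq] at h
  convert h using 1
  conv_lhs => rw [← Finsupp.univ_sum_single d, Fintype.sum_option, Fintype.sum_sum_type]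
  simp

variable (S)

theorem psi_monomial_mul_support (g : R) (d : Mon n) (c : K) :
    ∀ m ∈ (S.Psi (S.Psi.symm (monomial d c) * g) - monomial d c * S.Psi g).support,
      ∃ e ∈ (S.Psi g).support, mdeg m = mdeg (d + e) ∧ wdeg S.D.w m < wdeg S.D.w (d + e) := by
  have hc : S.Psi.symm (monomial d c) = c • S.monR d := by
    rw [monR, ← map_smul, smul_monomial, smul_eq_mul, mul_one]
  have hg : g = ∑ e ∈ (S.Psi g).support, (S.Psi g).coeff e • S.monR e := by
    apply S.Psi.injective
    conv_lhs => rw [(S.Psi g).as_sum]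
    simp [monR, smul_monomial]
  have hsum : S.Psi (S.Psi.symm (monomial d c) * g) - monomial d c * S.Psi g =
      ∑ e ∈ (S.Psi g).support,
        (c * (S.Psi g).coeff e) • S.Psi (S.monR d * S.monR e - S.monR (d + e)) := by
    have hP : monomial d c * S.Psi g = ∑ e ∈ (S.Psi g).support,
        (c * (S.Psi g).coeff e) • S.Psi (S.monR (d + e)) := by
      conv_lhs => rw [(S.Psi g).as_sum, Finset.mul_sum]
      simp [monR, smul_monomial, monomial_mul]
    rw [hP, hc]
    conv_lhs => rw [hg, Finset.mul_sum, map_sum]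
    rw [← hg, ← Finset.sum_sub_distrib]
    refine Finset.sum_congr rfl fun e _ => ?_
    rw [map_sub, smul_sub, smul_mul_smul_comm, map_smul]
  intro m hm
  rw [hsum, mem_support_iff, coeff_sum] at hm
  obtain ⟨e, he, hne⟩ := Finset.exists_ne_zero_of_sum_ne_zero hm
  refine ⟨e, he, S.support_of_mem_lower (actsLike_monR d e) m ?_⟩
  rw [coeff_smul] at hne
  exact mem_support_iff.mpr (right_ne_zero_of_mul hne)

theorem isLM_LMr {g : R} (hg : g ≠ 0) : IsLM S.D (S.Psi g) (S.LMr g) :=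
  isLM_LM S.D (by simpa using hg)

theorem LCr_ne_zero {g : R} (hg : g ≠ 0) : S.LCr g ≠ 0 :=
  mem_support_iff.mp (S.isLM_LMr hg).1

theorem isLM_monomial_mul {g : R} (hg : g ≠ 0) (d : Mon n) {c : K} (hc : c ≠ 0) :
    IsLM S.D (S.Psi (S.Psi.symm (monomial d c) * g)) (d + S.LMr g) := by
  have h := (S.isLM_LMr hg).monomial_mul_add (t := d) hc
    (q := S.Psi (S.Psi.symm (monomial d c) * g) - monomial d c * S.Psi g) fun m hm => ?_
  · rwa [add_sub_cancel] at h
  obtain ⟨e, he, h1, h2⟩ := S.psi_monomial_mul_support g d c m hm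
  simp only [DegLT, mdeg_add, wdeg_add] at h1 h2 ⊢
  by_cases hne : e = S.LMr g
  · subst hne
    exact Or.inr ⟨h1, h2⟩
  · rcases (S.isLM_LMr hg).2 e he hne with h | ⟨h, h' | ⟨h', _⟩⟩
    · exact Or.inl (by omega)
    · exact Or.inr ⟨by omega, by linarith⟩
    · exact Or.inr ⟨by omega, by linarith⟩

theorem LMr_monomial_mul {g : R} (hg : g ≠ 0) (d : Mon n) {c : K} (hc : c ≠ 0) :
    S.LMr (S.Psi.symm (monomial d c) * g) = d + S.LMr g :=
  (S.isLM_monomial_mul hg d hc).LM_eq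

theorem monomial_mul_ne_zero {g : R} (hg : g ≠ 0) (d : Mon n) {c : K} (hc : c ≠ 0) :
    S.Psi.symm (monomial d c) * g ≠ 0 := fun h => by
  have := (S.isLM_monomial_mul hg d hc).1
  simp [h] at this

/-- The lexicographic key by which `<_sign` compares module monomials. -/
def signKey (m : MMon n N) : Fin N ×ₗ ℕ ×ₗ ℝ ×ₗ Prop ×ₗ PrecMon S.D :=
  toLex (m.2, toLex (mdeg m.1, toLex (wdeg S.D.w m.1, toLex (S.inLSyz m, xiPart m.1))))

theorem ltSign_iff (m m' : MMon n N) : S.ltSign m m' ↔ S.signKey m < S.signKey m' := by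
  have h : ∀ p q : Prop, p < q ↔ ¬ p ∧ q := fun p q => by
    rw [lt_iff_le_not_ge]
    simp only [le_Prop_eq]
    tauto
  simp only [ltSign, signKey, Prod.Lex.toLex_lt_toLex, h, eq_iff_iff]
  rfl

theorem signKey_injective : Function.Injective S.signKey := fun m m' h => by
  obtain ⟨h1, h⟩ := Prod.ext_iff.mp h
  obtain ⟨h2, h⟩ := Prod.ext_iff.mp h
  obtain ⟨_, h⟩ := Prod.ext_iff.mp h
  exact Prod.ext (mon_eq_of_mdeg_of_xiPart h2 (Prod.ext_iff.mp h).2) h1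

theorem exists_min_signKey {A : Set (MMon n N)} (hA : A.Nonempty) :
    ∃ m ∈ A, ∀ m' ∈ A, S.signKey m ≤ S.signKey m' := by
  let f : MMon n N → Fin N ×ₗ ℕ := fun m => toLex (m.2, mdeg m.1)
  obtain ⟨m₀, hm₀, hmin⟩ := exists_minimalFor_of_wellFoundedLT (· ∈ A) f hA
  have hfin : {m : MMon n N | m ∈ A ∧ f m = f m₀}.Finite := by
    refine ((Finsupp.finite_of_degree_le (mdeg m₀.1)).prod (Set.finite_univ)).subset
      fun m hm => ⟨?_, trivial⟩
    have h := hm.2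
    simp only [f, EmbeddingLike.apply_eq_iff_eq, Prod.mk.injEq] at h
    exact h.2.le
  obtain ⟨m, hm, hle⟩ := Set.exists_min_image _ S.signKey hfin ⟨m₀, hm₀, rfl⟩
  refine ⟨m, hm.1, fun m' hm' => ?_⟩
  by_cases h : f m' = f m₀
  · exact hle m' ⟨hm', h⟩
  · have hlt : f m₀ < f m' := lt_of_le_of_ne
      ((le_total (f m₀) (f m')).elim id fun h' => hmin hm' h') (Ne.symm h)
    rw [← hm.2, Prod.Lex.toLex_lt_toLex] at hlt
    refine le_of_lt ?_
    simp only [signKey, Prod.Lex.toLex_lt_toLex]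
    rcases hlt with h | ⟨h, h'⟩
    · exact Or.inl h
    · exact Or.inr ⟨h, Or.inl h'⟩

theorem exists_isLMsign {a : Fin N → R} (ha : a ≠ 0) : ∃ m, S.IsLMsign a m := by
  have hfin : {m : MMon n N | m.1 ∈ (S.Psi (a m.2)).support}.Finite := by
    refine (Set.finite_iUnion fun i => ((S.Psi (a i)).support.finite_toSet.prod
      (Set.finite_singleton i))).subset fun m hm => ?_
    exact Set.mem_iUnion.mpr ⟨m.2, hm, rfl⟩
  obtain ⟨i, hi⟩ := Function.ne_iff.mp ha
  obtain ⟨d, hd⟩ : (S.Psi (a i)).support.Nonempty :=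
    support_nonempty.mpr (by simpa using hi)
  obtain ⟨m, hm, hle⟩ := Set.exists_max_image _ S.signKey hfin ⟨(d, i), hd⟩
  refine ⟨m, hm, fun m' hm' hne => (S.ltSign_iff _ _).mpr ?_⟩
  exact lt_of_le_of_ne (hle m' hm') (S.signKey_injective.ne hne)

theorem IsLMsign.signKey_le {S : Setting n N K R} {a : Fin N → R} {m m' : MMon n N}
    (h : S.IsLMsign a m) (hm' : m'.1 ∈ (S.Psi (a m'.2)).support) :
    S.signKey m' ≤ S.signKey m := by
  by_cases hne : m' = m
  · rw [hne]
  · exact ((S.ltSign_iff _ _).mp (h.2 m' hm' hne)).le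

theorem nu_add (a b : Fin N → R) : S.nu (a + b) = S.nu a + S.nu b := by
  simp [nu, add_mul, Finset.sum_add_distrib]

theorem nu_neg (a : Fin N → R) : S.nu (-a) = -S.nu a := by
  simp [nu]

theorem mem_idl_iff {f : R} : f ∈ S.idl ↔ ∃ a, S.nu a = f :=
  Submodule.mem_span_range_iff_exists_fun R

/-- `f` has a representation all of whose module monomials are at most `m`. -/
def SigLE (f : R) (m : MMon n N) : Prop :=
  ∃ a, S.nu a = f ∧
    ∀ m' : MMon n N, m'.1 ∈ (S.Psi (a m'.2)).support → S.signKey m' ≤ S.signKey m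

variable {S}

theorem SigLE.mono {f : R} {m m' : MMon n N} (h : S.SigLE f m)
    (hm : S.signKey m ≤ S.signKey m') : S.SigLE f m' := by
  obtain ⟨a, ha, hle⟩ := h
  exact ⟨a, ha, fun e he => (hle e he).trans hm⟩

theorem SigLE.neg {f : R} {m : MMon n N} (h : S.SigLE f m) : S.SigLE (-f) m := by
  obtain ⟨a, rfl, ha⟩ := h
  refine ⟨-a, S.nu_neg a, fun e he => ha e ?_⟩
  simpa using he

theorem SigLE.add {f g : R} {m : MMon n N} (hf : S.SigLE f m) (hg : S.SigLE g m) :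
    S.SigLE (f + g) m := by
  classical
  obtain ⟨a, rfl, ha⟩ := hf
  obtain ⟨b, rfl, hb⟩ := hg
  refine ⟨a + b, S.nu_add a b, fun e he => ?_⟩
  rw [Pi.add_apply, map_add] at he
  rcases Finset.mem_union.mp (support_add he) with h | h
  exacts [ha e h, hb e h]

variable (S) [NeZero N]

theorem isSig_sig {f : R} (hf : f ∈ S.idl) (h0 : f ≠ 0) : S.IsSig f (S.sig f) := by
  have hA : {m | ∃ a, S.nu a = f ∧ S.IsLMsign a m}.Nonempty := by
    obtain ⟨a, rfl⟩ := S.mem_idl_iff.mp hf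
    obtain ⟨m, hm⟩ := S.exists_isLMsign (a := a) fun h => h0 (by simp [h, nu])
    exact ⟨m, a, rfl, hm⟩
  obtain ⟨m, hm, hmin⟩ := S.exists_min_signKey hA
  have h : ∃ m, S.IsSig f m :=
    ⟨m, hm, fun a m' ha hm' => by
      rw [ltSign_iff, not_lt]
      exact hmin m' ⟨a, ha, hm'⟩⟩
  rw [sig, dif_pos h]
  exact h.choose_spec

variable {S}

theorem sigLE_sig {f : R} (hf : f ∈ S.idl) (h0 : f ≠ 0) : S.SigLE f (S.sig f) := by
  obtain ⟨⟨a, ha, hm⟩, _⟩ := S.isSig_sig hf h0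
  exact ⟨a, ha, fun m' hm' => hm.signKey_le hm'⟩

theorem SigLE.signKey_sig_le {f : R} {m : MMon n N} (h : S.SigLE f m) (h0 : f ≠ 0) :
    S.signKey (S.sig f) ≤ S.signKey m := by
  obtain ⟨a, rfl, ha⟩ := h
  obtain ⟨m', hm'⟩ := S.exists_isLMsign (a := a) fun h => h0 (by simp [h, nu])
  have hmin := (S.isSig_sig (S.mem_idl_iff.mpr ⟨a, rfl⟩) h0).2 a m' rfl hm'
  rw [ltSign_iff, not_lt] at hmin
  exact hmin.trans (ha m' hm'.1)

theorem sig_neg {f : R} (hf : f ∈ S.idl) (h0 : f ≠ 0) : S.sig (-f) = S.sig f := by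
  refine S.signKey_injective (le_antisymm
    ((sigLE_sig hf h0).neg.signKey_sig_le (neg_ne_zero.mpr h0)) ?_)
  have h := (sigLE_sig (neg_mem hf) (neg_ne_zero.mpr h0)).neg
  rw [neg_neg] at h
  exact h.signKey_sig_le h0

theorem sig_sub_of_lt {f g : R} (hf : f ∈ S.idl) (hf0 : f ≠ 0) (hg : g ∈ S.idl) (hg0 : g ≠ 0)
    (h : S.ltSign (S.sig g) (S.sig f)) : S.sig (f - g) = S.sig f := by
  rw [ltSign_iff] at h
  have hne : f - g ≠ 0 := fun h0 => by
    rw [sub_eq_zero.mp h0] at h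
    exact lt_irrefl _ h
  have hle : S.signKey (S.sig (f - g)) ≤ S.signKey (S.sig f) := by
    rw [sub_eq_add_neg]
    exact ((sigLE_sig hf hf0).add ((sigLE_sig hg hg0).mono h.le).neg).signKey_sig_le
      (by rwa [← sub_eq_add_neg])
  refine S.signKey_injective (le_antisymm hle ?_)
  by_contra! hlt
  have hd := sigLE_sig (sub_mem hf hg) hne
  have hg' := sigLE_sig hg hg0
  rcases le_total (S.signKey (S.sig (f - g))) (S.signKey (S.sig g)) with hc | hc
  · have := (hd.mono hc).add hg'
    rw [sub_add_cancel] at this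
    exact absurd (this.signKey_sig_le hf0) (not_le.mpr h)
  · have := hd.add (hg'.mono hc)
    rw [sub_add_cancel] at this
    exact absurd (this.signKey_sig_le hf0) (not_le.mpr hlt)

end Setting

end TropF5

open TropF5 MvPolynomial

variable {n N : ℕ} [NeZero N] {K R : Type*} [Field K] [Ring R] [Algebra K R]

/-- Remark `sig_normalpairs`. For a normal pair `(g₁,g₂)`,
`s(spair(g₁,g₂)) = max_{≤_sign}(s(u₁g₁), s(u₂g₂))`; moreover if `s(u₁g₁) >_sign s(u₂g₂)`
then `u₁ ≠ 1`. -/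
theorem stmt15 (S : Setting n N K R) (G : Set R) (g1 g2 : R)
    (h : S.NormalPair G g1 g2) :
    (S.ltSign (S.sig (S.u2 g1 g2 * g2)) (S.sig (S.u1 g1 g2 * g1)) →
        S.sig (S.spair g1 g2) = S.sig (S.u1 g1 g2 * g1)) ∧
    (S.ltSign (S.sig (S.u1 g1 g2 * g1)) (S.sig (S.u2 g1 g2 * g2)) →
        S.sig (S.spair g1 g2) = S.sig (S.u2 g1 g2 * g2)) ∧
    (S.ltSign (S.sig (S.u2 g1 g2 * g2)) (S.sig (S.u1 g1 g2 * g1)) → S.u1 g1 g2 ≠ 1) := by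
  obtain ⟨⟨hI1, hg1, hirr, _⟩, ⟨hI2, hg2, _, _⟩, _⟩ := h
  have hc1 := S.LCr_ne_zero hg1
  have hc2 := S.LCr_ne_zero hg2
  have hu1 : S.u1 g1 g2 * g1 ≠ 0 := S.monomial_mul_ne_zero hg1 _ hc2
  have hu2 : S.u2 g1 g2 * g2 ≠ 0 := S.monomial_mul_ne_zero hg2 _ hc1
  have hm1 : S.u1 g1 g2 * g1 ∈ S.idl := S.idl.smul_mem _ hI1
  have hm2 : S.u2 g1 g2 * g2 ∈ S.idl := S.idl.smul_mem _ hI2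
  refine ⟨Setting.sig_sub_of_lt hm1 hu1 hm2 hu2, fun hlt => ?_, fun hlt hone => ?_⟩
  · rw [← Setting.sig_sub_of_lt hm2 hu2 hm1 hu1 hlt, Setting.spair, ← neg_sub]
    refine Setting.sig_neg (sub_mem hm2 hm1) fun h0 => ?_
    rw [sub_eq_zero.mp h0, S.ltSign_iff] at hlt
    exact lt_irrefl _ hlt
  · rw [hone, one_mul] at hlt
    rw [← S.monR_zero, Setting.u1, Setting.monR, S.Psi.symm.injective.eq_iff,
      monomial_eq_monomial_iff] at hone
    have hd : (S.LMr g1 ⊔ S.LMr g2) - S.LMr g1 = 0 := by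
      rcases hone with h | h
      exacts [h.1, absurd h.2 one_ne_zero]
    have hsup : S.LMr g1 ⊔ S.LMr g2 = S.LMr g1 :=
      le_antisymm (tsub_eq_zero_iff_le.mp hd) le_sup_left
    refine hirr.resolve_left hg1 ⟨g2, hI2, hg2, S.u2 g1 g2,
      ⟨_, _, hc1, S.Psi.apply_symm_apply _⟩, ?_, hlt⟩
    · rw [Setting.u2, S.LMr_monomial_mul hg2 _ hc1, tsub_add_cancel_of_le le_sup_right, hsup]

end
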